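/- arXiv:2210.05445 — 2 statements merged into one kernel-verified Lean document; each statement's English description precedes it below -/
import Mathlib

section
/- For every complex z with Re(z) > 0, the s-derivative of E(s,z) = Σ_{k=0}^∞ z^{k+s}/Γ(1+k+s) evaluated at s = 0 equals −e^z Γ(0,z), where Γ(0,z) = ∫_z^∞ t^{-1} e^{-t} dt is the exponential integral (upper incomplete Gamma function at s = 0). In other words, E_1(z) = −e^z Γ(0,z). -/
open Complex MeasureTheory Set

/-- The exponential integral `Γ(0,z) = ∫_z^∞ e^{-t}/t dt`, along the ray from `z` to `+∞`. -/
noncomputable def expInt (z : ℂ) : ℂ :=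
  ∫ t in Ioi (0:ℝ), Complex.exp (-(z + t)) / (z + t)

open Filter Topology

/-- The integrand `u^{s-1} e^{-zu}` of the Gamma integral with complex rate `z`. -/
noncomputable def gammaKernel (s z : ℂ) (u : ℝ) : ℂ :=
  (u : ℂ) ^ (s - 1) * Complex.exp (-(z * u))

lemma norm_gammaKernel (s z : ℂ) {u : ℝ} (hu : 0 < u) :
    ‖gammaKernel s z u‖ = u ^ (s.re - 1) * Real.exp (-(z.re * u)) := by
  simp [gammaKernel, norm_cpow_eq_rpow_re_of_pos hu, Complex.norm_exp]

lemma continuousOn_gammaKernel (s z : ℂ) : ContinuousOn (gammaKernel s z) (Ioi 0) := by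
  intro u hu
  have h : ContinuousAt (fun u : ℝ => (u : ℂ) ^ (s - 1)) u :=
    continuousAt_ofReal_cpow_const _ _ (Or.inr (ne_of_gt hu))
  exact (h.mul (by fun_prop)).continuousWithinAt

lemma aestronglyMeasurable_gammaKernel (s z : ℂ) {a : ℝ} (ha : 0 ≤ a) :
    AEStronglyMeasurable (gammaKernel s z) (volume.restrict (Ioi a)) :=
  ((continuousOn_gammaKernel s z).mono (Ioi_subset_Ioi ha)).aestronglyMeasurable measurableSet_Ioi

lemma integrableOn_rpow_mul_exp_neg {q b : ℝ} (hq : 0 < q) (hb : 0 < b) :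
    IntegrableOn (fun u : ℝ => u ^ (q - 1) * Real.exp (-(b * u))) (Ioi 0) := by
  simpa using integrableOn_rpow_mul_exp_neg_mul_rpow (s := q - 1) (by linarith) one_pos hb

lemma integrableOn_gammaKernel_zero {s z : ℂ} (hs : 0 < s.re) (hz : 0 < z.re) :
    IntegrableOn (gammaKernel s z) (Ioi 0) := by
  refine (integrableOn_rpow_mul_exp_neg hs hz).mono'
    (aestronglyMeasurable_gammaKernel s z le_rfl) ?_
  filter_upwards [ae_restrict_mem measurableSet_Ioi] with u hu
  exact (norm_gammaKernel s z hu).le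

lemma integrableOn_gammaKernel_one (s : ℂ) {z : ℂ} (hz : 0 < z.re) :
    IntegrableOn (gammaKernel s z) (Ioi 1) := by
  refine ((integrableOn_rpow_mul_exp_neg (q := |s.re| + 1) (by positivity) hz).mono_set
    (Ioi_subset_Ioi zero_le_one)).mono' (aestronglyMeasurable_gammaKernel s z zero_le_one) ?_
  filter_upwards [ae_restrict_mem measurableSet_Ioi] with u hu
  rw [norm_gammaKernel s z (zero_lt_one.trans hu)]
  have : s.re ≤ |s.re| := le_abs_self _
  gcongr
  · exact le_of_lt hu
  · linarith

/-- Integration by parts for the Gamma integral over `(a, ∞)`. -/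
lemma integral_gammaKernel_add_one {s z : ℂ} {a : ℝ} (ha : 0 ≤ a) (hz : 0 < z.re)
    (hsa : a ≠ 0 ∨ 0 < s.re) (h₀ : IntegrableOn (gammaKernel s z) (Ioi a))
    (h₁ : IntegrableOn (gammaKernel (s + 1) z) (Ioi a)) :
    z * ∫ u in Ioi a, gammaKernel (s + 1) z u =
      (a : ℂ) ^ s * Complex.exp (-(z * a)) + s * ∫ u in Ioi a, gammaKernel s z u := by
  have key := integral_Ioi_of_hasDerivAt_of_tendsto (a := a) (m := 0)
    (f := gammaKernel (s + 1) z)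
    (f' := fun u => s * gammaKernel s z u - z * gammaKernel (s + 1) z u) ?_ ?_
    ((h₀.const_mul s).sub (h₁.const_mul z)) ?_
  · rw [integral_sub (h₀.const_mul s) (h₁.const_mul z), integral_const_mul,
      integral_const_mul] at key
    have : gammaKernel (s + 1) z a = (a : ℂ) ^ s * Complex.exp (-(z * a)) := by
      simp [gammaKernel]
    rw [← this]
    linear_combination -key
  · have h : ContinuousAt (fun u : ℝ => (u : ℂ) ^ (s + 1 - 1)) a :=
      continuousAt_ofReal_cpow_const _ _ (by simpa [or_comm] using hsa)
    exact (h.mul (by fun_prop)).continuousWithinAt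
  · intro u hu
    have hu0 : 0 < u := ha.trans_lt hu
    have hd : HasDerivAt (fun w : ℂ => w ^ s * Complex.exp (-(z * w)))
        (s * (u : ℂ) ^ (s - 1) * 1 * Complex.exp (-(z * u)) +
          (u : ℂ) ^ s * (Complex.exp (-(z * u)) * (-(z * 1)))) u :=
      ((hasDerivAt_id (u : ℂ)).cpow_const (Or.inl (by simpa using hu0))).mul
        (((hasDerivAt_id (u : ℂ)).const_mul z).neg.cexp)
    have hfun : gammaKernel (s + 1) z = fun v : ℝ => (v : ℂ) ^ s * Complex.exp (-(z * v)) := by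
      ext v; simp [gammaKernel]
    rw [hfun]
    refine hd.comp_ofReal.congr_deriv ?_
    simp only [gammaKernel]
    ring
  · rw [tendsto_zero_iff_norm_tendsto_zero]
    refine (tendsto_rpow_mul_exp_neg_mul_atTop_nhds_zero s.re z.re hz).congr' ?_
    filter_upwards [eventually_gt_atTop 0] with u hu
    rw [norm_gammaKernel _ _ hu]
    simp

lemma hasDerivAt_integral_gammaKernel {s z : ℂ} (hs : 0 < s.re) (hz : 0 < z.re) :
    HasDerivAt (fun w => ∫ u in Ioi (0 : ℝ), gammaKernel s w u)
      (-∫ u in Ioi (0 : ℝ), gammaKernel (s + 1) z u) z := by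
  rw [← integral_neg]
  have hopen : {w : ℂ | z.re / 2 < w.re} ∈ 𝓝 z :=
    (isOpen_lt continuous_const continuous_re).mem_nhds (by simp; linarith)
  refine (hasDerivAt_integral_of_dominated_loc_of_deriv_le
    (F' := fun w u => -gammaKernel (s + 1) w u)
    (bound := fun u => u ^ (s.re + 1 - 1) * Real.exp (-(z.re / 2 * u))) hopen
    (Eventually.of_forall fun w => aestronglyMeasurable_gammaKernel s w le_rfl)
    (integrableOn_gammaKernel_zero hs hz)
    (aestronglyMeasurable_gammaKernel (s + 1) z le_rfl).neg ?_
    (integrableOn_rpow_mul_exp_neg (by linarith) (by linarith)) ?_).2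
  · filter_upwards [ae_restrict_mem measurableSet_Ioi] with u hu w hw
    have hu : 0 < u := hu
    rw [norm_neg, norm_gammaKernel _ _ hu, add_re, one_re]
    have : z.re / 2 ≤ w.re := le_of_lt hw
    gcongr
  · filter_upwards [ae_restrict_mem measurableSet_Ioi] with u hu w _
    have hu0 : (u : ℂ) ≠ 0 := ofReal_ne_zero.2 (ne_of_gt hu)
    convert! (((hasDerivAt_id w).mul_const (u : ℂ)).neg.cexp).const_mul ((u : ℂ) ^ (s - 1)) using 1
    have : (u : ℂ) ^ s = (u : ℂ) ^ (s - 1) * u := by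
      rw [cpow_sub _ _ hu0, cpow_one]; field_simp
    simp [gammaKernel, this]; ring

/-- The Gamma integral with a complex rate. -/
lemma cpow_mul_integral_gammaKernel {s z : ℂ} (hs : 0 < s.re) (hz : 0 < z.re) :
    z ^ s * ∫ u in Ioi (0 : ℝ), gammaKernel s z u = Complex.Gamma s := by
  set U : Set ℂ := {w : ℂ | 0 < w.re}
  have hU : IsOpen U := isOpen_lt continuous_const continuous_re
  have hd : ∀ w ∈ U, HasDerivAt (fun w => w ^ s * ∫ u in Ioi (0 : ℝ), gammaKernel s w u) 0 w := by
    intro w hw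
    have hw : 0 < w.re := hw
    have hw0 : w ≠ 0 := by rintro rfl; simp at hw
    have hparts := integral_gammaKernel_add_one (s := s) (z := w) le_rfl hw (Or.inr hs)
      (integrableOn_gammaKernel_zero hs hw)
      (integrableOn_gammaKernel_zero (by simp; linarith) hw)
    have hs0 : s ≠ 0 := by rintro rfl; simp at hs
    rw [ofReal_zero, zero_cpow hs0, zero_mul, zero_add] at hparts
    convert! ((hasDerivAt_id w).cpow_const (c := s) (Or.inl hw)).mul
      (hasDerivAt_integral_gammaKernel hs hw) using 1
    have : w ^ s = w ^ (s - 1) * w := by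
      rw [cpow_sub _ _ hw0, cpow_one]; field_simp
    simp only [id, this]
    linear_combination w ^ (s - 1) * hparts
  have hconst := (convex_halfSpace_re_gt 0).is_const_of_fderivWithin_eq_zero (𝕜 := ℂ)
    (f := fun w => w ^ s * ∫ u in Ioi (0 : ℝ), gammaKernel s w u)
    (fun w hw => (hd w hw).differentiableAt.differentiableWithinAt) ?_ (x := z) (y := 1) hz (by simp)
  · rw [hconst, one_cpow, one_mul, Gamma_eq_integral hs, GammaIntegral]
    refine setIntegral_congr_fun measurableSet_Ioi fun u _ => ?_
    simp [gammaKernel, mul_comm]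
  · intro w hw
    rw [fderivWithin_of_isOpen hU hw]
    ext
    simp [(hd w hw).hasFDerivAt.fderiv]

/-- `Γ(s,z)` as an integral along the ray from `z` in the direction of `z`. -/
noncomputable def rayGamma (s z : ℂ) : ℂ := z ^ s * ∫ u in Ioi (1 : ℝ), gammaKernel s z u

lemma rayGamma_add_one (s : ℂ) {z : ℂ} (hz : 0 < z.re) :
    rayGamma (s + 1) z = z ^ s * Complex.exp (-z) + s * rayGamma s z := by
  have hz0 : z ≠ 0 := by rintro rfl; simp at hz
  have h := integral_gammaKernel_add_one (s := s) (z := z) zero_le_one hz (Or.inl one_ne_zero)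
    (integrableOn_gammaKernel_one s hz) (integrableOn_gammaKernel_one (s + 1) hz)
  rw [ofReal_one, one_cpow, mul_one, one_mul] at h
  rw [rayGamma, rayGamma, cpow_add _ _ hz0, cpow_one]
  linear_combination z ^ s * h

lemma norm_Gamma_sub_rayGamma_le {s z : ℂ} (hs : 1 ≤ s.re) (hz : 0 < z.re) :
    ‖Complex.Gamma s - rayGamma s z‖ ≤ ‖z ^ s‖ := by
  have hs' : 0 < s.re := by linarith
  have hint := integrableOn_gammaKernel_zero hs' hz
  rw [← cpow_mul_integral_gammaKernel hs' hz, rayGamma, ← mul_sub,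
    ← Ioc_union_Ioi_eq_Ioi (zero_le_one (α := ℝ)),
    setIntegral_union (Ioc_disjoint_Ioi le_rfl) measurableSet_Ioi
      (hint.mono_set Ioc_subset_Ioi_self) (integrableOn_gammaKernel_one s hz),
    add_sub_cancel_right, norm_mul]
  refine mul_le_of_le_one_right (norm_nonneg _) ?_
  refine (norm_setIntegral_le_of_norm_le_const (C := 1) (by simp) fun u hu => ?_).trans (by simp)
  rw [norm_gammaKernel _ _ hu.1]
  refine mul_le_one₀ (Real.rpow_le_one hu.1.le hu.2 (by linarith)) (Real.exp_pos _).le ?_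
  rw [Real.exp_le_one_iff]
  have := mul_pos hz hu.1
  linarith

lemma summable_cpow_div_Gamma {s z : ℂ} (hs : -1 < s.re) (hz : z ≠ 0) :
    Summable fun k : ℕ => z ^ ((k : ℂ) + s) / Complex.Gamma (1 + k + s) := by
  have hre (k : ℕ) : 0 < (1 + k + s).re := by
    have : (0 : ℝ) ≤ k := k.cast_nonneg
    simp; linarith
  have hne (k : ℕ) : 1 + k + s ≠ 0 := fun h => by simpa [h] using hre k
  have hG (k : ℕ) : Complex.Gamma (1 + k + s) ≠ 0 := Gamma_ne_zero_of_re_pos (hre k)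
  have hp (k : ℕ) : z ^ ((k : ℂ) + s) ≠ 0 := by simp [cpow_eq_zero_iff, hz]
  refine summable_of_ratio_test_tendsto_lt_one zero_lt_one
    (Eventually.of_forall fun k => div_ne_zero (hp k) (hG k)) ?_
  have hratio (k : ℕ) : z ^ (((k + 1 : ℕ) : ℂ) + s) / Complex.Gamma (1 + (k + 1 : ℕ) + s) =
      z / (1 + k + s) * (z ^ ((k : ℂ) + s) / Complex.Gamma (1 + k + s)) := by
    rw [show (1 + ((k + 1 : ℕ) : ℂ) + s) = (1 + k + s) + 1 by push_cast; ring,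
      show (((k + 1 : ℕ) : ℂ) + s) = (k + s) + 1 by push_cast; ring,
      Gamma_add_one _ (hne k), cpow_add _ _ hz, cpow_one]
    have := hG k
    have := hne k
    field_simp
  simp_rw [hratio, norm_mul, mul_div_assoc]
  have hcancel (k : ℕ) : ‖z ^ ((k : ℂ) + s) / Complex.Gamma (1 + k + s)‖ ≠ 0 :=
    norm_ne_zero_iff.2 (div_ne_zero (hp k) (hG k))
  simp_rw [div_self (hcancel _), mul_one]
  rw [← tendsto_zero_iff_norm_tendsto_zero]
  have : Tendsto (fun k : ℕ => (k : ℂ) + (1 + s)) atTop (Bornology.cobounded ℂ) :=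
    tendsto_add_const_cobounded _ |>.comp tendsto_natCast_atTop_cobounded
  refine ((tendsto_inv₀_cobounded.comp this).const_mul z).congr' ?_ |>.trans (by simp)
  filter_upwards with k
  simp [div_eq_mul_inv]; left; ring

/-- `E(s,z) = e^z (1 - Γ(s,z)/Γ(s))`. -/
lemma tsum_cpow_div_Gamma {s z : ℂ} (hs : -1 < s.re) (hz : 0 < z.re) :
    ∑' k : ℕ, z ^ ((k : ℂ) + s) / Complex.Gamma (1 + k + s) =
      Complex.exp z * (1 - rayGamma s z * (Complex.Gamma s)⁻¹) := by
  have hz0 : z ≠ 0 := by rintro rfl; simp at hz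
  have hsum := summable_cpow_div_Gamma hs hz0
  have hpartial (n : ℕ) : ∑ k ∈ Finset.range n, z ^ ((k : ℂ) + s) / Complex.Gamma (1 + k + s) =
      Complex.exp z * (rayGamma (n + s) z * (Complex.Gamma (n + s))⁻¹
        - rayGamma s z * (Complex.Gamma s)⁻¹) := by
    induction n with
    | zero => simp
    | succ n ih =>
      rw [Finset.sum_range_succ, ih, one_div_Gamma_eq_self_mul_one_div_Gamma_add_one (n + s),
        show (((n + 1 : ℕ) : ℂ) + s) = (n + s) + 1 by push_cast; ring, rayGamma_add_one _ hz,
        show (1 + (n : ℂ) + s) = (n + s) + 1 by ring, Complex.exp_neg]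
      have := Complex.exp_ne_zero z
      field_simp
      ring
  refine tendsto_nhds_unique ((tendsto_add_atTop_iff_nat 1).2 hsum.hasSum.tendsto_sum_nat) ?_
  simp_rw [hpartial]
  refine (Tendsto.sub_const ?_ _).const_mul _
  rw [tendsto_iff_norm_sub_tendsto_zero]
  have hlim := (hsum.tendsto_atTop_zero.norm.mul_const ‖z‖)
  rw [norm_zero, zero_mul] at hlim
  refine squeeze_zero' (Eventually.of_forall fun _ => norm_nonneg _) ?_ hlim
  filter_upwards [eventually_ge_atTop 1] with n hn
  have hn : (1 : ℝ) ≤ n := by exact_mod_cast hn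
  have hre : 1 ≤ (((n + 1 : ℕ) : ℂ) + s).re := by simp; linarith
  have hG : Complex.Gamma (((n + 1 : ℕ) : ℂ) + s) ≠ 0 := Gamma_ne_zero_of_re_pos (by linarith)
  have hle := norm_Gamma_sub_rayGamma_le hre hz
  rw [show (1 + (n : ℂ) + s) = ((n + 1 : ℕ) : ℂ) + s by push_cast; ring, ← norm_mul]
  have hpow : z ^ (((n + 1 : ℕ) : ℂ) + s) = z ^ ((n : ℂ) + s) * z := by
    rw [show (((n + 1 : ℕ) : ℂ) + s) = (n + s) + 1 by push_cast; ring, cpow_add _ _ hz0, cpow_one]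
  rw [hpow] at hle
  rw [div_mul_eq_mul_div, norm_div, ← div_eq_mul_inv, div_sub_one hG, norm_div, norm_sub_rev]
  gcongr

lemma continuousAt_rayGamma_zero {z : ℂ} (hz : 0 < z.re) :
    ContinuousAt (fun s => rayGamma s z) 0 := by
  have hz0 : z ≠ 0 := by rintro rfl; simp at hz
  refine (continuousAt_const_cpow hz0).mul ?_
  have hopen : {s : ℂ | s.re < 1} ∈ 𝓝 (0 : ℂ) :=
    (isOpen_lt continuous_re continuous_const).mem_nhds (by simp)
  refine continuousAt_of_dominated (bound := fun u => u ^ ((1 : ℝ) - 1) * Real.exp (-(z.re * u)))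
    (Eventually.of_forall fun s => aestronglyMeasurable_gammaKernel s z zero_le_one) ?_
    ((integrableOn_rpow_mul_exp_neg one_pos hz).mono_set (Ioi_subset_Ioi zero_le_one)) ?_
  · filter_upwards [hopen] with s hs
    filter_upwards [ae_restrict_mem measurableSet_Ioi] with u hu
    have hs : s.re ≤ 1 := le_of_lt hs
    have hu1 : 1 ≤ u := le_of_lt hu
    rw [norm_gammaKernel _ _ (zero_lt_one.trans hu)]
    gcongr
  · filter_upwards [ae_restrict_mem measurableSet_Ioi] with u hu
    have hu0 : (u : ℂ) ≠ 0 := ofReal_ne_zero.2 (zero_lt_one.trans hu).ne'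
    have h : ContinuousAt (fun s : ℂ => (u : ℂ) ^ (s - 1)) 0 :=
      ContinuousAt.const_cpow (by fun_prop) (Or.inl hu0)
    exact h.mul continuousAt_const

lemma rayGamma_zero {z : ℂ} (hz : 0 < z.re) : rayGamma 0 z = expInt z := by
  have hint : Integrable (Function.uncurry fun t v : ℝ => Complex.exp (-((z + t) * (1 + v))))
      ((volume.restrict (Ioi 0)).prod (volume.restrict (Ioi 0))) := by
    have hb : Integrable (fun p : ℝ × ℝ => Real.exp (-1 * p.1) * Real.exp (-z.re * p.2))
        ((volume.restrict (Ioi 0)).prod (volume.restrict (Ioi 0))) :=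
      (integrableOn_exp_mul_Ioi (by norm_num) 0).mul_prod
        (integrableOn_exp_mul_Ioi (neg_lt_zero.2 hz) 0)
    refine hb.mono' (by fun_prop) ?_
    rw [Measure.prod_restrict]
    filter_upwards [ae_restrict_mem (measurableSet_Ioi.prod measurableSet_Ioi)] with p hp
    have h₁ : 0 < p.1 := hp.1
    have h₂ : 0 < p.2 := hp.2
    rw [Function.uncurry, Complex.norm_exp, ← Real.exp_add, Real.exp_le_exp]
    simp
    nlinarith [mul_pos h₁ h₂]
  have hswap := integral_integral_swap hint
  have hleft (t : ℝ) (ht : t ∈ Ioi (0 : ℝ)) :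
      ∫ v in Ioi (0 : ℝ), Complex.exp (-((z + t) * (1 + v))) =
        Complex.exp (-(z + t)) / (z + t) := by
    have ht : 0 < t := ht
    have := integral_exp_mul_complex_Ioi (a := -(z + t)) (by simp; linarith) 0
    have h (v : ℝ) : Complex.exp (-((z + t) * (1 + v))) =
        Complex.exp (-(z + t)) * Complex.exp (-(z + t) * v) := by
      rw [← Complex.exp_add]; ring_nf
    simp_rw [h, integral_const_mul, this, ofReal_zero, mul_zero, Complex.exp_zero, neg_div_neg_eq]
    ring
  have hright (v : ℝ) (hv : v ∈ Ioi (0 : ℝ)) :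
      ∫ t in Ioi (0 : ℝ), Complex.exp (-((z + t) * (1 + v))) =
        gammaKernel 0 z (v + 1) := by
    have hv : 0 < v := hv
    have := integral_exp_mul_complex_Ioi (a := -(1 + v)) (by simp; linarith) 0
    have h (t : ℝ) : Complex.exp (-((z + t) * (1 + v))) =
        Complex.exp (-(z * (v + 1))) * Complex.exp (-(1 + v) * t) := by
      rw [← Complex.exp_add]; ring_nf
    simp_rw [h, integral_const_mul, this, ofReal_zero, mul_zero, Complex.exp_zero, neg_div_neg_eq]
    simp [gammaKernel, cpow_neg_one, mul_comm, add_comm]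
  rw [setIntegral_congr_fun measurableSet_Ioi hleft,
    setIntegral_congr_fun measurableSet_Ioi hright] at hswap
  rw [rayGamma, cpow_zero, one_mul, expInt, hswap]
  have hshift := (measurePreserving_add_right volume (1 : ℝ)).setIntegral_preimage_emb
    (measurableEmbedding_addRight 1) (gammaKernel 0 z) (Ioi 1)
  simpa using hshift.symm

/-- For `Re z > 0`, the `s`-derivative at `s = 0` of
`E(s,z) = ∑_{k=0}^∞ z^{k+s}/Γ(1+k+s)` equals `−e^z Γ(0,z)`; i.e. `E₁(z) = −e^z Γ(0,z)`. -/
theorem deriv_calE_at_zero (z : ℂ) (hz : 0 < z.re) :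
    HasDerivAt (fun s : ℂ => ∑' k : ℕ, z ^ ((k : ℂ) + s) / Complex.Gamma (1 + k + s))
      (-Complex.exp z * expInt z) 0 := by
  have hopen : {s : ℂ | -1 < s.re} ∈ 𝓝 (0 : ℂ) :=
    (isOpen_lt continuous_const continuous_re).mem_nhds (by simp)
  have heq : (fun s : ℂ => ∑' k : ℕ, z ^ ((k : ℂ) + s) / Complex.Gamma (1 + k + s)) =ᶠ[𝓝 0]
      fun s => Complex.exp z * (1 - rayGamma s z * (Complex.Gamma s)⁻¹) := by
    filter_upwards [hopen] with s hs using tsum_cpow_div_Gamma hs hz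
  refine HasDerivAt.congr_of_eventuallyEq ?_ heq
  have hQ : ContinuousAt (fun s => rayGamma s z * (Complex.Gamma (s + 1))⁻¹) 0 :=
    (continuousAt_rayGamma_zero hz).mul
      (differentiable_one_div_Gamma.continuous.comp (continuous_add_const 1)).continuousAt
  have hD : HasDerivAt (fun s => rayGamma s z * (Complex.Gamma s)⁻¹) (expInt z) 0 := by
    rw [hasDerivAt_iff_tendsto_slope]
    have hlim := hQ.tendsto.mono_left (nhdsWithin_le_nhds (s := {0}ᶜ))
    rw [zero_add, Gamma_one, inv_one, mul_one, rayGamma_zero hz] at hlim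
    refine hlim.congr' ?_
    filter_upwards [self_mem_nhdsWithin] with s hs
    have hs : s ≠ 0 := hs
    rw [slope_def_field, one_div_Gamma_eq_self_mul_one_div_Gamma_add_one s, Gamma_zero]
    field_simp
    simp
  simpa using (hD.const_sub 1).const_mul (Complex.exp z)
end

section
/- The reciprocal Gamma function has the power series expansion 1/Γ(s) = Σ_{n=0}^∞ (β_n / n!) s^{n+1} valid in a neighborhood of s = 0, where β_n := B_n(0!·γ_EM, −1!·ζ(2), 2!·ζ(3), −3!·ζ(4), …, (−1)^{n+1}(n−1)!·ζ(n)) is built from complete Bell polynomials, γ_EM is the Euler–Mascheroni constant, and ζ is the Riemann zeta function. -/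
open Finset

/-- The complete Bell polynomials, evaluated on a sequence `x : ℕ → ℂ` (indexed from 1):
`B₀ = 1`, `B_{n+1}(x₁,…,x_{n+1}) = ∑_{k=0}^n binom(n,k) B_{n−k}(x₁,…,x_{n−k}) x_{k+1}`. -/
noncomputable def bellPoly : ℕ → (ℕ → ℂ) → ℂ
  | 0, _ => 1
  | (n + 1), x => ∑ k ∈ Finset.range (n + 1),
      (n.choose k : ℂ) * bellPoly (n - k) x * x (k + 1)
  termination_by n _ => n
  decreasing_by omega

/-- The sequence `β_n := B_n(0!·γ_EM, −1!·ζ(2), 2!·ζ(3), −3!·ζ(4), …,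
(−1)^{n+1}(n−1)!·ζ(n))`. -/
noncomputable def betaSeq (n : ℕ) : ℂ :=
  bellPoly n (fun j => if j = 1 then (Real.eulerMascheroniConstant : ℂ)
    else (-1) ^ (j + 1) * Nat.factorial (j - 1) * riemannZeta j)

/-- The recursion of the complete Bell polynomials is the Leibniz rule for the derivative of `exp Q`. -/
lemma iteratedDeriv_cexp_eq_bellPoly {Q : ℂ → ℂ} {x : ℕ → ℂ} (hQ : AnalyticAt ℂ Q 0)
    (hQ0 : Q 0 = 0) (hx : ∀ n, iteratedDeriv (n + 1) Q 0 = x (n + 1)) (n : ℕ) :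
    iteratedDeriv n (fun s ↦ Complex.exp (Q s)) 0 = bellPoly n x := by
  induction n using Nat.strong_induction_on with
  | _ n ih =>
    cases n with
    | zero => simp [hQ0, bellPoly]
    | succ n =>
      have hderiv : deriv (fun s ↦ Complex.exp (Q s)) =ᶠ[nhds 0]
          fun s ↦ deriv Q s * Complex.exp (Q s) := by
        filter_upwards [hQ.eventually_analyticAt] with s hs
        rw [hs.differentiableAt.hasDerivAt.cexp.deriv, mul_comm]
      rw [iteratedDeriv_succ', hderiv.iteratedDeriv_eq,
        iteratedDeriv_fun_mul (g := fun s ↦ Complex.exp (Q s)) hQ.deriv.contDiffAt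
          hQ.cexp.contDiffAt, bellPoly]
      refine Finset.sum_congr rfl fun k _ ↦ ?_
      rw [← iteratedDeriv_succ', hx, ih (n - k) (by omega)]
      ring

lemma analyticAt_and_iteratedDeriv_of_hasSum {f : ℂ → ℂ} {c : ℕ → ℂ}
    (h : ∀ᶠ z in nhds 0, HasSum (fun n ↦ c n * z ^ n) (f z)) :
    AnalyticAt ℂ f 0 ∧ ∀ n, iteratedDeriv n f 0 = n.factorial * c n := by
  have hf : HasFPowerSeriesAt f (FormalMultilinearSeries.ofScalars ℂ c) 0 := by
    rw [hasFPowerSeriesAt_iff]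
    simpa [FormalMultilinearSeries.coeff_ofScalars, mul_comm] using h
  refine ⟨hf.analyticAt, fun n ↦ ?_⟩
  have := congrArg (fun p ↦ p.coeff n)
    (hf.analyticAt.hasFPowerSeriesAt.eq_formalMultilinearSeries hf)
  simp only [FormalMultilinearSeries.coeff_ofScalars] at this
  rw [← this, mul_div_cancel₀ _ (Nat.cast_ne_zero.2 n.factorial_ne_zero)]

lemma norm_div_natCast_add_one_le (s : ℂ) (j : ℕ) : ‖s / (j + 1)‖ ≤ ‖s‖ := by
  rw [norm_div]
  refine div_le_self (norm_nonneg s) ?_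
  rw [← Nat.cast_add_one, Complex.norm_natCast]
  simp

lemma exp_log_one_add_div {s : ℂ} (hs : ‖s‖ < 1) (j : ℕ) :
    Complex.exp (Complex.log (1 + s / (j + 1))) = 1 + s / (j + 1) := by
  refine Complex.exp_log fun h ↦ ?_
  have := norm_div_natCast_add_one_le s j
  rw [eq_neg_of_add_eq_zero_right h, norm_neg, norm_one] at this
  linarith

lemma prod_add_one_add_natCast (s : ℂ) (n : ℕ) :
    ∏ j ∈ Finset.range n, (s + 1 + j) =
      n.factorial * ∏ j ∈ Finset.range n, (1 + s / ((j : ℂ) + 1)) := by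
  induction n with
  | zero => simp
  | succ n ih =>
    have : (n : ℂ) + 1 ≠ 0 := Nat.cast_add_one_ne_zero n
    rw [Finset.prod_range_succ, ih, Finset.prod_range_succ, Nat.factorial_succ]
    push_cast
    field_simp
    ring

lemma sum_inv_eq_harmonic (n : ℕ) :
    ∑ j ∈ Finset.range n, (1 : ℂ) / (j + 1) = ((harmonic n : ℝ) : ℂ) := by
  simp [harmonic]

lemma inv_GammaSeq_add_one {s : ℂ} (hs : ‖s‖ < 1) {n : ℕ} (hn : n ≠ 0) :
    (Complex.GammaSeq (s + 1) n)⁻¹ =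
      Complex.exp (s * ((harmonic n - Real.log n : ℝ) : ℂ) +
        ∑ j ∈ Finset.range n, (Complex.log (1 + s / (j + 1)) - s / (j + 1))) *
      (1 + (s + 1) / n) := by
  have hn' : (n : ℂ) ≠ 0 := Nat.cast_ne_zero.2 hn
  have hf : (n.factorial : ℂ) ≠ 0 := Nat.cast_ne_zero.2 n.factorial_ne_zero
  have hsum : ∑ j ∈ Finset.range n, s / ((j : ℂ) + 1) = s * ((harmonic n : ℝ) : ℂ) := by
    rw [← sum_inv_eq_harmonic, Finset.mul_sum]
    exact Finset.sum_congr rfl fun j _ ↦ by ring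
  have hexp : s * ((harmonic n - Real.log n : ℝ) : ℂ) +
      ∑ j ∈ Finset.range n, (Complex.log (1 + s / (j + 1)) - s / (j + 1)) =
      ∑ j ∈ Finset.range n, Complex.log (1 + s / (j + 1)) - Complex.log n * s := by
    rw [Finset.sum_sub_distrib, hsum, Complex.ofReal_sub, Complex.ofReal_log n.cast_nonneg,
      Complex.ofReal_natCast]
    ring
  rw [hexp, Complex.exp_sub, Complex.exp_sum, Finset.prod_congr rfl fun j _ ↦
    exp_log_one_add_div hs j, Complex.GammaSeq, Finset.prod_range_succ,
    prod_add_one_add_natCast, Complex.cpow_add _ _ hn', Complex.cpow_one,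
    Complex.cpow_def_of_ne_zero hn']
  have := Complex.exp_ne_zero (Complex.log n * s)
  field_simp
  ring

lemma inv_Gamma_add_one_eq_exp {s L : ℂ} (hs : ‖s‖ < 1)
    (hL : HasSum (fun j : ℕ ↦ Complex.log (1 + s / (j + 1)) - s / (j + 1)) L) :
    (Complex.Gamma (s + 1))⁻¹ = Complex.exp (s * Real.eulerMascheroniConstant + L) := by
  have hre : 0 < (s + 1).re := by
    have := (abs_le.1 (Complex.abs_re_le_norm s)).1
    simp only [Complex.add_re, Complex.one_re]
    linarith
  have h₁ := (Complex.GammaSeq_tendsto_Gamma (s + 1)).inv₀ (Complex.Gamma_ne_zero_of_re_pos hre)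
  have h₂ : Filter.Tendsto (fun n : ℕ ↦ 1 + (s + 1) / (n : ℂ)) Filter.atTop (nhds (1 + 0)) :=
    (tendsto_const_div_atTop_nhds_zero_nat (s + 1)).const_add 1
  have h₃ := (((Complex.continuous_ofReal.tendsto _).comp
    Real.tendsto_harmonic_sub_log).const_mul s).add hL.tendsto_sum_nat
  have h₄ := ((Complex.continuous_exp.tendsto _).comp h₃).mul h₂
  rw [add_zero, mul_one] at h₄
  refine tendsto_nhds_unique h₁ (h₄.congr' ?_)
  filter_upwards [Filter.eventually_ne_atTop 0] with n hn
  exact (inv_GammaSeq_add_one hs hn).symm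

lemma hasSum_log_one_add_sub {z : ℂ} (hz : ‖z‖ < 1) :
    HasSum (fun k : ℕ ↦ (-1) ^ (k + 3) * z ^ (k + 2) / ((k : ℂ) + 2)) (Complex.log (1 + z) - z) := by
  have := (hasSum_nat_add_iff' 2).2 (Complex.hasSum_taylorSeries_log hz)
  simpa [Finset.sum_range_succ, add_assoc] using this

lemma hasSum_inv_pow_riemannZeta (k : ℕ) :
    HasSum (fun j : ℕ ↦ 1 / ((j : ℂ) + 1) ^ (k + 2)) (riemannZeta (k + 2)) := by
  have hsum : Summable fun n : ℕ ↦ 1 / (n : ℂ) ^ (k + 2) := by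
    have := Complex.summable_one_div_nat_cpow (p := ((k + 2 : ℕ) : ℂ)) |>.2 (by norm_cast; simp)
    simpa only [Complex.cpow_natCast] using this
  have h := hsum.hasSum
  rw [← zeta_nat_eq_tsum_of_gt_one (by omega), ← hasSum_nat_add_iff' 1] at h
  simpa using h

lemma summable_prod_pow_div {s : ℂ} (hs : ‖s‖ < 1) :
    Summable fun p : ℕ × ℕ ↦
      (-1) ^ (p.2 + 3) * (s / ((p.1 : ℂ) + 1)) ^ (p.2 + 2) / ((p.2 : ℂ) + 2) := by
  have h₁ : Summable fun j : ℕ ↦ 1 / ((j : ℝ) + 1) ^ 2 := by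
    simpa using (summable_nat_add_iff 1).2 (Real.summable_one_div_nat_pow.2 one_lt_two)
  have h₂ := summable_geometric_of_lt_one (norm_nonneg s) hs
  refine (h₁.mul_of_nonneg h₂ (fun j ↦ by positivity) fun k ↦ by positivity).of_norm_bounded ?_
  rintro ⟨j, k⟩
  have hj : ‖(j : ℂ) + 1‖ = (j : ℝ) + 1 := by
    rw [← Nat.cast_add_one, Complex.norm_natCast, Nat.cast_add_one]
  have hk : ‖(k : ℂ) + 2‖ = (k : ℝ) + 2 := by
    exact_mod_cast Complex.norm_natCast (k + 2)
  simp only [norm_div, norm_mul, norm_pow, norm_neg, norm_one, one_pow, one_mul, hj, hk, div_pow]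
  have hpow : ((j : ℝ) + 1) ^ 2 ≤ ((j : ℝ) + 1) ^ (k + 2) :=
    pow_le_pow_right₀ (by simp) (by omega)
  calc ‖s‖ ^ (k + 2) / ((j : ℝ) + 1) ^ (k + 2) / ((k : ℝ) + 2)
      ≤ ‖s‖ ^ (k + 2) / ((j : ℝ) + 1) ^ (k + 2) :=
        div_le_self (by positivity) (by linarith [k.cast_nonneg (α := ℝ)])
    _ ≤ ‖s‖ ^ k / ((j : ℝ) + 1) ^ 2 := by
        gcongr ?_ / ?_
        exact pow_le_pow_of_le_one (norm_nonneg s) hs.le (by omega)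
    _ = 1 / ((j : ℝ) + 1) ^ 2 * ‖s‖ ^ k := by ring

lemma exists_hasSum_and_hasSum_of_summable {f : ℕ → ℕ → ℂ} {g h : ℕ → ℂ}
    (hf : Summable fun p : ℕ × ℕ ↦ f p.1 p.2) (hg : ∀ j, HasSum (f j) (g j))
    (hh : ∀ k, HasSum (fun j ↦ f j k) (h k)) : ∃ L, HasSum g L ∧ HasSum h L :=
  ⟨_, hf.hasSum.prod_fiberwise hg,
    ((Equiv.prodComm ℕ ℕ).hasSum_iff.2 hf.hasSum).prod_fiberwise hh⟩

lemma exists_hasSum_log_and_hasSum_zeta {s : ℂ} (hs : ‖s‖ < 1) :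
    ∃ L, HasSum (fun j : ℕ ↦ Complex.log (1 + s / (j + 1)) - s / (j + 1)) L ∧
      HasSum (fun k : ℕ ↦ (-1) ^ (k + 3) * riemannZeta (k + 2) / ((k : ℂ) + 2) * s ^ (k + 2)) L := by
  refine exists_hasSum_and_hasSum_of_summable
    (f := fun j k ↦ (-1) ^ (k + 3) * (s / ((j : ℂ) + 1)) ^ (k + 2) / ((k : ℂ) + 2))
    (summable_prod_pow_div hs)
    (fun j ↦ hasSum_log_one_add_sub ((norm_div_natCast_add_one_le s j).trans_lt hs)) fun k ↦ ?_
  have h := (hasSum_inv_pow_riemannZeta k).mul_left ((-1) ^ (k + 3) * s ^ (k + 2) / ((k : ℂ) + 2))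
  have hval : (-1) ^ (k + 3) * s ^ (k + 2) / ((k : ℂ) + 2) * riemannZeta (k + 2) =
      (-1) ^ (k + 3) * riemannZeta (k + 2) / ((k : ℂ) + 2) * s ^ (k + 2) := by
    generalize riemannZeta (k + 2) = z
    ring
  rw [hval] at h
  refine h.congr_fun fun j ↦ ?_
  simp only [div_pow]
  generalize (k : ℂ) + 2 = a
  generalize (j : ℂ) + 1 = b
  ring

/-- The coefficients of the Legendre series `-log Γ(1 + s)`. -/
noncomputable def legendreCoeff : ℕ → ℂ
  | 0 => 0
  | 1 => Real.eulerMascheroniConstant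
  | k + 2 => (-1) ^ (k + 3) * riemannZeta (k + 2) / ((k : ℂ) + 2)

lemma exists_hasSum_legendreCoeff {s : ℂ} (hs : ‖s‖ < 1) :
    ∃ q, HasSum (fun k ↦ legendreCoeff k * s ^ k) q ∧
      (Complex.Gamma (s + 1))⁻¹ = Complex.exp q := by
  obtain ⟨L, hL, hζ⟩ := exists_hasSum_log_and_hasSum_zeta hs
  refine ⟨_, ?_, inv_Gamma_add_one_eq_exp hs hL⟩
  rw [← hasSum_nat_add_iff' 2]
  simpa [Finset.sum_range_succ, legendreCoeff, mul_comm s] using hζ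

lemma iteratedDeriv_inv_Gamma_add_one (n : ℕ) :
    iteratedDeriv n (fun s ↦ (Complex.Gamma (s + 1))⁻¹) 0 = betaSeq n := by
  let Q : ℂ → ℂ := fun s ↦ ∑' k, legendreCoeff k * s ^ k
  have hball : ∀ᶠ s : ℂ in nhds 0, ‖s‖ < 1 := by
    filter_upwards [Metric.ball_mem_nhds (0 : ℂ) one_pos] with s hs using mem_ball_zero_iff.1 hs
  have hQ : ∀ᶠ s in nhds 0, HasSum (fun k ↦ legendreCoeff k * s ^ k) (Q s) := by
    filter_upwards [hball] with s hs
    exact (exists_hasSum_legendreCoeff hs).choose_spec.1.summable.hasSum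
  obtain ⟨hQan, hQderiv⟩ := analyticAt_and_iteratedDeriv_of_hasSum hQ
  have hG : (fun s ↦ (Complex.Gamma (s + 1))⁻¹) =ᶠ[nhds 0] fun s ↦ Complex.exp (Q s) := by
    filter_upwards [hball] with s hs
    obtain ⟨q, hq, hΓ⟩ := exists_hasSum_legendreCoeff hs
    rw [hΓ, hq.tsum_eq.symm]
  rw [hG.iteratedDeriv_eq, betaSeq]
  refine iteratedDeriv_cexp_eq_bellPoly hQan ?_ (fun k ↦ ?_) n
  · simpa [legendreCoeff] using hQderiv 0
  · rw [hQderiv]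
    cases k with
    | zero => simp [legendreCoeff]
    | succ k =>
      have : (k : ℂ) + 2 ≠ 0 := by exact_mod_cast (k + 1).succ_ne_zero
      rw [if_neg (by omega), legendreCoeff, Nat.factorial_succ (k + 1), Nat.add_sub_cancel]
      push_cast
      rw [show (k : ℂ) + 1 + 1 = k + 2 by ring]
      field_simp

/-- The reciprocal Gamma function has the expansion `1/Γ(s) = ∑_{n=0}^∞ (β_n/n!) s^{n+1}`
in a neighborhood of `s = 0`. -/
theorem one_div_Gamma_eq_tsum_betaSeq :
    ∃ r : ℝ, 0 < r ∧ ∀ s : ℂ, ‖s‖ < r →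
      HasSum (fun n : ℕ => betaSeq n / (Nat.factorial n : ℂ) * s ^ (n + 1))
        (1 / Complex.Gamma s) := by
  have hG : Differentiable ℂ fun s ↦ (Complex.Gamma (s + 1))⁻¹ :=
    Complex.differentiable_one_div_Gamma.comp (differentiable_id.add_const 1)
  refine ⟨1, one_pos, fun s _ ↦ ?_⟩
  have h := (Complex.hasSum_taylorSeries_of_entire hG 0 s).mul_left s
  simp only [iteratedDeriv_inv_Gamma_add_one] at h
  rw [one_div, Complex.one_div_Gamma_eq_self_mul_one_div_Gamma_add_one]
  refine h.congr_fun fun n ↦ ?_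
  simp only [sub_zero, smul_eq_mul]
  ring
end
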